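/- Let L be a finite-dimensional Lie algebra over a field K of characteristic zero. If H^1(L, V) = 0 for every finite-dimensional non-trivial irreducible L-module V, then H^{dim L − 1}(L, V) = 0 for every finite-dimensional non-trivial irreducible L-module V. -/

import Mathlib

/-! Chevalley–Eilenberg cohomology of a Lie algebra, and the predicate
`CE.cohomologyVanishes K L V n` expressing `Hⁿ(L, V) = 0`. -/

namespace CE

variable {K : Type} [CommRing K] {L : Type} [LieRing L] [LieAlgebra K L]
  {V : Type} [AddCommGroup V] [Module K V] [LieRingModule L V] [LieModule K L V]

/-- The Chevalley–Eilenberg differential of an alternating `n`-cochain, as a raw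
function on `(n+1)`-tuples of elements of `L`:
`(d f)(x₀,…,xₙ) = ∑ᵢ (-1)ⁱ xᵢ · f(x₀,…,x̂ᵢ,…,xₙ)
  + ∑_{i<j} (-1)ʲ f(x₀,…,x_{i-1},⁅xᵢ,xⱼ⁆,x_{i+1},…,x̂ⱼ,…,xₙ)`. -/
def d {n : ℕ} (f : L [⋀^Fin n]→ₗ[K] V) (x : Fin (n + 1) → L) : V :=
  (∑ i : Fin (n + 1), ((-1 : K) ^ (i : ℕ)) • ⁅x i, f (x ∘ i.succAbove)⁆) +
  ∑ j : Fin (n + 1), ∑ i : Fin (n + 1),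
    if h : (i : ℕ) < (j : ℕ) then
      ((-1 : K) ^ (j : ℕ)) •
        f (Function.update (x ∘ j.succAbove)
            ⟨(i : ℕ), lt_of_lt_of_le h (Nat.lt_succ_iff.mp j.isLt)⟩ ⁅x i, x j⁆)
    else 0

variable (K L V) in
/-- `Hⁿ(L, V) = 0`, expressed via the Chevalley–Eilenberg complex: in degree `0`
every invariant `0`-cochain is zero (recall `H⁰(L,V) = Vᴸ`), and in degree `n + 1`
every cocycle is a coboundary. -/
def cohomologyVanishes : ℕ → Prop
  | 0 => ∀ f : L [⋀^Fin 0]→ₗ[K] V, (∀ x, d f x = 0) → f = 0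
  | (m + 1) => ∀ f : L [⋀^Fin (m + 1)]→ₗ[K] V,
      (∀ x, d f x = 0) → ∃ g : L [⋀^Fin m]→ₗ[K] V, ∀ x, f x = d g x

end CE

namespace CE

section Cartan

variable {K : Type} [CommRing K] {L : Type} [LieRing L] [LieAlgebra K L]
  {V : Type} [AddCommGroup V] [Module K V]

/-- The action of an endomorphism on alternating maps by derivations of the arguments. -/
def derivArgs {n : ℕ} (A : L →ₗ[K] L) (f : L [⋀^Fin n]→ₗ[K] V) : L [⋀^Fin n]→ₗ[K] V where
  toMultilinearMap := ∑ j : Fin n, f.toMultilinearMap.compLinearMap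
    (fun i => if i = j then A else LinearMap.id)
  map_eq_zero_of_eq' v i k hv hik := by
    have key : ∀ j, (fun l => (if l = j then A else LinearMap.id : L →ₗ[K] L) (v l))
        = Function.update v j (A (v j)) := by
      intro j
      ext l
      rcases eq_or_ne l j with rfl | h
      · simp
      · simp [h]
    simp only [MultilinearMap.toFun_eq_coe, sum_apply,
      MultilinearMap.compLinearMap_apply, key]
    rw [Fintype.sum_eq_add i k hik]
    · have : Function.update v k (A (v k)) = Function.update v i (A (v i)) ∘ Equiv.swap i k := by
        ext l
        rcases eq_or_ne l i with rfl | hi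
        · simp [hik, hik.symm, hv]
        · rcases eq_or_ne l k with rfl | hk
          · simp [hv]
          · simp [hi, hk, Equiv.swap_apply_of_ne_of_ne]
      rw [this]
      exact f.map_add_swap _ hik
    · rintro j ⟨hji, hjk⟩
      exact f.map_eq_zero_of_eq _ (by simp [hji.symm, hjk.symm, hv]) hik

theorem derivArgs_apply {n : ℕ} (A : L →ₗ[K] L) (f : L [⋀^Fin n]→ₗ[K] V) (v : Fin n → L) :
    derivArgs A f v = ∑ j, f (Function.update v j (A (v j))) := by
  change (∑ j : Fin n, f.toMultilinearMap.compLinearMap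
    (fun i => if i = j then A else LinearMap.id)) v = _
  rw [sum_apply]
  refine Finset.sum_congr rfl fun j _ => ?_
  rw [MultilinearMap.compLinearMap_apply]
  change f _ = _
  congr 1
  ext l
  rcases eq_or_ne l j with rfl | h
  · simp
  · simp [h]

variable [LieRingModule L V]

theorem d_zero (f : L [⋀^Fin 0]→ₗ[K] V) (v : Fin 1 → L) : d f v = ⁅v 0, f ![]⁆ := by
  have : f (v ∘ Fin.succ) = f ![] := congrArg f (Subsingleton.elim _ _)
  simp [d, this]

theorem d_add {n : ℕ} (f g : L [⋀^Fin n]→ₗ[K] V) (v : Fin (n + 1) → L) :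
    d (f + g) v = d f v + d g v := by
  unfold d
  rw [add_add_add_comm]
  congr 1
  · rw [← Finset.sum_add_distrib]
    exact Finset.sum_congr rfl fun i _ => by simp
  · rw [← Finset.sum_add_distrib]
    refine Finset.sum_congr rfl fun j _ => ?_
    rw [← Finset.sum_add_distrib]
    refine Finset.sum_congr rfl fun i _ => ?_
    split_ifs <;> simp

variable [LieModule K L V]

/-- The Lie derivative of alternating cochains. -/
def lieDeriv {n : ℕ} (f : L [⋀^Fin n]→ₗ[K] V) : L →ₗ[K] L [⋀^Fin n]→ₗ[K] V where
  toFun x := (LieModule.toEnd K L V x).compAlternatingMap f - derivArgs (LieAlgebra.ad K L x) f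
  map_add' x y := by
    ext v
    simp [derivArgs_apply, Finset.sum_add_distrib]
    abel
  map_smul' t x := by
    ext v
    simp [derivArgs_apply, Finset.smul_sum, smul_sub]

theorem lieDeriv_apply {n : ℕ} (f : L [⋀^Fin n]→ₗ[K] V) (x : L) (v : Fin n → L) :
    lieDeriv f x v = ⁅x, f v⁆ - ∑ j, f (Function.update v j ⁅x, v j⁆) := by
  simp [lieDeriv, derivArgs_apply]

theorem update_vecCons_succ {α : Type} {n : ℕ} (x a : α) (v : Fin n → α) (j : Fin n) :
    Function.update (Matrix.vecCons x v) j.succ a = Matrix.vecCons x (Function.update v j a) := by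
  simp [Matrix.vecCons, Fin.cons_update]

theorem update_vecCons_zero {α : Type} {n : ℕ} (x a : α) (v : Fin n → α) :
    Function.update (Matrix.vecCons x v) 0 a = Matrix.vecCons a v := by
  simp [Matrix.vecCons]

/-- `[L_x, ι_y] = ι_[x, y]`. -/
theorem lieDeriv_vecCons {n : ℕ} (f : L [⋀^Fin (n + 1)]→ₗ[K] V) (x y : L) (v : Fin n → L) :
    lieDeriv f x (Matrix.vecCons y v) =
      lieDeriv (f.curryLeft y) x v - f (Matrix.vecCons ⁅x, y⁆ v) := by
  simp only [lieDeriv_apply, Fin.sum_univ_succ, Matrix.cons_val_zero, Matrix.cons_val_succ,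
    update_vecCons_zero, update_vecCons_succ, AlternatingMap.curryLeft_apply_apply]
  abel

theorem vecCons_comp_succAbove_zero {α : Type} {n : ℕ} (x : α) (v : Fin n → α) :
    Matrix.vecCons x v ∘ (0 : Fin (n + 1)).succAbove = v := by
  ext i
  simp

theorem vecCons_comp_succAbove_succ {α : Type} {n : ℕ} (x : α) (v : Fin (n + 1) → α)
    (j : Fin (n + 1)) :
    Matrix.vecCons x v ∘ j.succ.succAbove = Matrix.vecCons x (v ∘ j.succAbove) := by
  ext i
  cases i using Fin.cases <;> simp

/-- Cartan's formula `d ι_x + ι_x d = L_x`. -/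
theorem d_vecCons {n : ℕ} (f : L [⋀^Fin (n + 1)]→ₗ[K] V) (x : L) (v : Fin (n + 1) → L) :
    d f (Matrix.vecCons x v) = lieDeriv f x v - d (f.curryLeft x) v := by
  have h1 : ∀ j : Fin (n + 1), ((-1 : K) ^ ((j : ℕ) + 1)) •
      f (Matrix.vecCons ⁅x, v j⁆ (v ∘ j.succAbove)) = - f (Function.update v j ⁅x, v j⁆) := by
    intro j
    have h := f.map_insertNth j ⁅x, v j⁆ (j.removeNth v)
    rw [Fin.insertNth_removeNth] at h
    rw [h]
    change _ = -((-1 : ℤ) ^ (j : ℕ) • f (Matrix.vecCons ⁅x, v j⁆ (v ∘ j.succAbove)))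
    rcases Nat.even_or_odd (j : ℕ) with hj | hj
    · rw [hj.add_one.neg_one_pow, hj.neg_one_pow]
      simp
    · rw [hj.add_one.neg_one_pow, hj.neg_one_pow]
      simp
  have h2 : ∀ i j : Fin (n + 1),
      (if h : (i.succ : ℕ) < (j.succ : ℕ) then
        ((-1 : K) ^ (j.succ : ℕ)) • f (Function.update (Matrix.vecCons x (v ∘ j.succAbove))
          ⟨(i.succ : ℕ), lt_of_lt_of_le h (Nat.lt_succ_iff.mp j.succ.isLt)⟩ ⁅v i, v j⁆)
       else 0) =
      - (if h : (i : ℕ) < (j : ℕ) then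
        ((-1 : K) ^ (j : ℕ)) • f.curryLeft x (Function.update (v ∘ j.succAbove)
          ⟨(i : ℕ), lt_of_lt_of_le h (Nat.lt_succ_iff.mp j.isLt)⟩ ⁅v i, v j⁆)
       else 0) := by
    intro i j
    by_cases h : (i : ℕ) < (j : ℕ)
    · rw [dif_pos h, dif_pos (by simpa using h), AlternatingMap.curryLeft_apply_apply,
        ← update_vecCons_succ, ← neg_smul]
      congr 1
      simp [pow_succ]
    · rw [dif_neg h, dif_neg (by simpa using h), neg_zero]
  have h3 : (∑ j : Fin (n + 2), ∑ i : Fin (n + 2),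
      if h : (i : ℕ) < (j : ℕ) then
        ((-1 : K) ^ (j : ℕ)) • f (Function.update (Matrix.vecCons x v ∘ j.succAbove)
          ⟨(i : ℕ), lt_of_lt_of_le h (Nat.lt_succ_iff.mp j.isLt)⟩
          ⁅Matrix.vecCons x v i, Matrix.vecCons x v j⁆)
      else 0) = (∑ j : Fin (n + 1), - f (Function.update v j ⁅x, v j⁆)) -
      ∑ j : Fin (n + 1), ∑ i : Fin (n + 1),
      if h : (i : ℕ) < (j : ℕ) then
        ((-1 : K) ^ (j : ℕ)) • f.curryLeft x (Function.update (v ∘ j.succAbove)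
          ⟨(i : ℕ), lt_of_lt_of_le h (Nat.lt_succ_iff.mp j.isLt)⟩ ⁅v i, v j⁆)
      else 0 := by
    rw [Fin.sum_univ_succ, ← Finset.sum_sub_distrib]
    rw [Finset.sum_eq_zero (fun i _ => dif_neg (by simp)), zero_add]
    refine Finset.sum_congr rfl fun j _ => ?_
    rw [Fin.sum_univ_succ, sub_eq_add_neg, ← Finset.sum_neg_distrib]
    simp only [vecCons_comp_succAbove_succ, Matrix.cons_val_succ, h2]
    congr 1
    rw [dif_pos (by simp), ← h1]
    exact congrArg _ (congrArg f (update_vecCons_zero ..))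
  unfold d
  rw [h3, Fin.sum_univ_succ, lieDeriv_apply]
  simp only [vecCons_comp_succAbove_succ, Matrix.cons_val_succ, vecCons_comp_succAbove_zero,
    AlternatingMap.curryLeft_apply_apply, Finset.sum_neg_distrib, Fin.val_succ, pow_succ,
    mul_neg, mul_one, neg_smul, Fin.val_zero, pow_zero, one_smul, Matrix.cons_val_zero]
  abel

theorem d_smul {n : ℕ} (t : K) (f : L [⋀^Fin n]→ₗ[K] V) (v : Fin (n + 1) → L) :
    d (t • f) v = t • d f v := by
  unfold d
  rw [smul_add, Finset.smul_sum, Finset.smul_sum]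
  congr 1
  · refine Finset.sum_congr rfl fun i _ => by simp [smul_comm t]
  · refine Finset.sum_congr rfl fun j _ => ?_
    rw [Finset.smul_sum]
    refine Finset.sum_congr rfl fun i _ => ?_
    split_ifs <;> simp [smul_comm t]

/-- The Chevalley–Eilenberg differential of an alternating cochain is alternating. -/
theorem exists_linearMap_eq_d (n : ℕ) :
    ∃ D : (L [⋀^Fin n]→ₗ[K] V) →ₗ[K] (L [⋀^Fin (n + 1)]→ₗ[K] V), ∀ f v, D f v = d f v := by
  suffices h : ∀ f : L [⋀^Fin n]→ₗ[K] V, ∃ F : L [⋀^Fin (n + 1)]→ₗ[K] V, ∀ v, F v = d f v by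
    choose D hD using h
    exact ⟨{ toFun := D
             map_add' := fun f g => by ext v; simp [hD, d_add]
             map_smul' := fun t f => by ext v; simp [hD, d_smul] }, hD⟩
  induction n with
  | zero =>
    intro f
    let c : L →ₗ[K] V :=
      { toFun x := ⁅x, f ![]⁆
        map_add' x y := by simp
        map_smul' t x := by simp }
    refine ⟨AlternatingMap.ofSubsingleton K L V (0 : Fin 1) c, fun v => ?_⟩
    simp [c, d_zero]
  | succ n ih =>
    intro f
    choose D hD using ih
    let φ : L →ₗ[K] L [⋀^Fin (n + 1)]→ₗ[K] V :=
      { toFun x := lieDeriv f x - D (f.curryLeft x)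
        map_add' x y := by ext v; simp [hD, d_add]; abel
        map_smul' t x := by ext v; simp [hD, d_smul, smul_sub] }
    have hφ : ∀ x v, φ x v = d f (Matrix.vecCons x v) := fun x v => by
      rw [d_vecCons, ← hD]
      rfl
    have hφ0 : ∀ x v, φ x (Matrix.vecCons x v) = 0 := fun x v => by
      have hf : f (Matrix.vecCons 0 v) = 0 := f.map_coord_zero 0 rfl
      rw [hφ, d_vecCons, lieDeriv_vecCons, lie_self, hf, sub_zero, sub_eq_zero]
      cases n with
      | zero =>
        rw [d_zero, lieDeriv_apply, Fin.sum_univ_zero, sub_zero, Matrix.cons_val_zero]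
        exact congrArg _ (congrArg _ (Subsingleton.elim _ _))
      | succ n =>
        have : d (0 : L [⋀^Fin n]→ₗ[K] V) v = 0 := by
          simpa using d_smul (0 : K) (0 : L [⋀^Fin n]→ₗ[K] V) v
        rw [d_vecCons, AlternatingMap.curryLeft_same, this, sub_zero]
    have hφ1 : ∀ (v : Fin (n + 1) → L) j, φ (v j) v = 0 := fun v j => by
      have h := (φ (v j)).map_insertNth j (v j) (j.removeNth v)
      rw [Fin.insertNth_self_removeNth, hφ0, smul_zero] at h
      exact h
    refine ⟨{ LinearMap.uncurryLeft (M := fun _ => L)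
        (AlternatingMap.toMultilinearMapLM (S := K) ∘ₗ φ) with
        map_eq_zero_of_eq' := fun v i j hv hij => ?_ }, fun v => ?_⟩
    · change φ (v 0) (Fin.tail v) = 0
      cases i using Fin.cases with
      | zero =>
        cases j using Fin.cases with
        | zero => exact absurd rfl hij
        | succ j => rw [hv]; exact hφ1 (Fin.tail v) j
      | succ i =>
        cases j using Fin.cases with
        | zero => rw [← hv]; exact hφ1 (Fin.tail v) i
        | succ j =>
          exact (φ (v 0)).map_eq_zero_of_eq _ hv (fun h => hij (congrArg _ h))
    · change φ (v 0) (Fin.tail v) = d f v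
      rw [hφ]
      exact congrArg _ (Fin.cons_self_tail v)

end Cartan

/-- Vanishing of `H¹(L, V)`, in terms of linear maps satisfying the cocycle identity. -/
theorem exists_eq_lie_of_cohomologyVanishes_one
    {K : Type} [CommRing K] {L : Type} [LieRing L] [LieAlgebra K L]
    {V : Type} [AddCommGroup V] [Module K V] [LieRingModule L V] [LieModule K L V]
    (h : cohomologyVanishes K L V 1) (c : L →ₗ[K] V)
    (hc : ∀ x y, c ⁅x, y⁆ = ⁅x, c y⁆ - ⁅y, c x⁆) : ∃ v, ∀ x, c x = ⁅x, v⁆ := by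
  obtain ⟨g, hg⟩ := h (AlternatingMap.ofSubsingleton K L V (0 : Fin 1) c) (by
    intro x
    obtain ⟨y, v, rfl⟩ : ∃ y v, x = Matrix.vecCons y v :=
      ⟨x 0, Fin.tail x, (Fin.cons_self_tail x).symm⟩
    rw [d_vecCons, d_zero, lieDeriv_apply]
    simp [hc])
  refine ⟨g ![], fun x => ?_⟩
  have := hg ![x]
  rw [d_zero] at this
  simpa using this

theorem eq_zero_of_forall_lie_eq_zero {K : Type} [Field K] {L : Type} [LieRing L] [LieAlgebra K L]
    {V : Type} [AddCommGroup V] [Module K V] [LieRingModule L V] [LieModule K L V]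
    (hV : LieModule.IsIrreducible K L V) (hT : ¬ LieModule.IsTrivial L V)
    {v : V} (hv : ∀ x : L, ⁅x, v⁆ = 0) : v = 0 := by
  rcases hV.eq_bot_or_eq_top (LieModule.maxTrivSubmodule K L V) with h | h
  · have : v ∈ LieModule.maxTrivSubmodule K L V := hv
    simpa [h] using this
  · exact absurd ((LieModule.isTrivial_iff_max_triv_eq_top K L V).2 h) hT

/-- An invariant functional on a nontrivial irreducible module vanishes. -/
theorem functional_eq_zero_of_isIrreducible {K : Type} [Field K]
    {L : Type} [LieRing L] [LieAlgebra K L]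
    {V : Type} [AddCommGroup V] [Module K V] [LieRingModule L V] [LieModule K L V]
    (hV : LieModule.IsIrreducible K L V) (hT : ¬ LieModule.IsTrivial L V)
    (φ : V →ₗ[K] K) (hφ : ∀ (x : L) v, φ ⁅x, v⁆ = 0) : φ = 0 := by
  let N : LieSubmodule K L V := { LinearMap.ker φ with lie_mem := fun {x m} _ => hφ x m }
  have hN : ∀ v, v ∈ N ↔ φ v = 0 := fun v => Iff.rfl
  rcases hV.eq_bot_or_eq_top N with h | h
  · refine absurd ⟨fun x v => ?_⟩ hT
    have := (hN ⁅x, v⁆).2 (hφ x v)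
    simpa [h] using this
  · ext v
    exact (hN v).1 (h ▸ LieSubmodule.mem_top v)

theorem exists_isIrreducible_lieSubmodule (K : Type) [Field K] (L : Type) [LieRing L]
    [LieAlgebra K L] (V : Type) [AddCommGroup V] [Module K V] [LieRingModule L V]
    [LieModule K L V] [FiniteDimensional K V] [Nontrivial V] :
    ∃ N : LieSubmodule K L V, LieModule.IsIrreducible K L N := by
  obtain ⟨N, hN⟩ := IsAtomic.exists_atom (LieSubmodule K L V)
  have : Nontrivial N := (LieSubmodule.nontrivial_iff_ne_bot K L V).2 hN.1
  refine ⟨N, LieModule.IsIrreducible.mk fun M hM => ?_⟩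
  have hle : M.map N.incl ≤ N := by
    rw [LieSubmodule.map_le_iff_le_comap]
    intro m _
    simp
  rcases hN.le_iff.1 hle with h | h
  · refine absurd ?_ hM
    rw [eq_bot_iff]
    intro m hm
    have : N.incl m ∈ M.map N.incl := LieSubmodule.mem_map_of_mem hm
    simpa [h] using this
  · rw [eq_top_iff]
    intro m _
    have : (m : V) ∈ M.map N.incl := by rw [h]; exact m.2
    obtain ⟨m', hm', e⟩ := LieSubmodule.mem_map _ |>.1 this
    rwa [← Subtype.ext e]

section H1

variable {K : Type} [Field K] {L : Type} [LieRing L] [LieAlgebra K L]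

/-- If `H¹` vanishes on nontrivial irreducible modules, a module without invariants has no
nonzero invariant functionals. -/
theorem functional_eq_zero_of_no_invariants
    (h1 : ∀ (V : Type) [AddCommGroup V] [Module K V] [LieRingModule L V]
      [LieModule K L V] [FiniteDimensional K V],
      LieModule.IsIrreducible K L V → ¬ LieModule.IsTrivial L V →
      cohomologyVanishes K L V 1)
    (n : ℕ) : ∀ (V : Type) [AddCommGroup V] [Module K V]
    [LieRingModule L V] [LieModule K L V] [FiniteDimensional K V], Module.finrank K V = n →
    (∀ v : V, (∀ x : L, ⁅x, v⁆ = 0) → v = 0) →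
    ∀ φ : V →ₗ[K] K, (∀ (x : L) v, φ ⁅x, v⁆ = 0) → φ = 0 := by
  induction n using Nat.strong_induction_on with
  | _ n ih =>
  intro V _ _ _ _ _ hn hV φ hφ
  rcases subsingleton_or_nontrivial V with hs | hs
  · ext v
    simp [Subsingleton.elim v 0]
  obtain ⟨N, hN⟩ := exists_isIrreducible_lieSubmodule K L V
  have : Nontrivial N := (LieSubmodule.nontrivial_iff K L N).1 hN.toNontrivial
  have hT : ¬ LieModule.IsTrivial L N := by
    intro hT
    obtain ⟨v, hv⟩ := exists_ne (0 : N)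
    refine hv (Subtype.ext (hV v fun x => ?_))
    have := hT.trivial x v
    simpa using congrArg Subtype.val this
  have hφN : ∀ v ∈ N, φ v = 0 := fun v hv => by
    have := functional_eq_zero_of_isIrreducible hN hT (φ ∘ₗ (N : Submodule K V).subtype)
      (fun x w => hφ x w)
    exact LinearMap.congr_fun this ⟨v, hv⟩
  have hlt : Module.finrank K (V ⧸ N) < n := by
    have h₁ := Submodule.finrank_quotient_add_finrank (N : Submodule K V)
    have h₂ : 0 < Module.finrank K N := Module.finrank_pos
    have h₃ : Module.finrank K (V ⧸ N) = Module.finrank K (V ⧸ (N : Submodule K V)) := rfl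
    have h₄ : Module.finrank K N = Module.finrank K (N : Submodule K V) := rfl
    omega
  have hinv : ∀ q : V ⧸ N, (∀ x : L, ⁅x, q⁆ = 0) → q = 0 := by
    intro q hq
    obtain ⟨v, rfl⟩ := LieSubmodule.Quotient.surjective_mk' N q
    have hmem : ∀ x : L, ⁅x, v⁆ ∈ N := fun x => by
      have := hq x
      rwa [← LieModuleHom.map_lie, LieSubmodule.Quotient.mk'_apply,
        LieSubmodule.Quotient.mk_eq_zero'] at this
    let c : L →ₗ[K] N :=
      { toFun x := ⟨⁅x, v⁆, hmem x⟩
        map_add' x y := Subtype.ext (by simp)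
        map_smul' t x := Subtype.ext (by simp) }
    obtain ⟨w, hw⟩ := exists_eq_lie_of_cohomologyVanishes_one (h1 N hN hT) c
      (fun x y => Subtype.ext (by simp [c]))
    have : v - w = 0 := hV _ fun x => by
      have := congrArg Subtype.val (hw x)
      simpa [c, sub_eq_zero] using this
    rw [LieSubmodule.Quotient.mk'_apply, LieSubmodule.Quotient.mk_eq_zero', sub_eq_zero.1 this]
    exact w.2
  have := ih _ hlt (V ⧸ N) rfl hinv ((N : Submodule K V).liftQ φ hφN) (by
    intro x q
    obtain ⟨v, rfl⟩ := LieSubmodule.Quotient.surjective_mk' N q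
    rw [← LieModuleHom.map_lie]
    exact hφ x v)
  ext v
  exact LinearMap.congr_fun this (LieSubmodule.Quotient.mk v)

theorem functional_eq_zero_of_normalizer_eq
    (h1 : ∀ (V : Type) [AddCommGroup V] [Module K V] [LieRingModule L V]
      [LieModule K L V] [FiniteDimensional K V],
      LieModule.IsIrreducible K L V → ¬ LieModule.IsTrivial L V →
      cohomologyVanishes K L V 1)
    (V : Type) [AddCommGroup V] [Module K V]
    [LieRingModule L V] [LieModule K L V] [FiniteDimensional K V] (Z : LieSubmodule K L V)
    (hZ : Z.normalizer = Z) (φ : V →ₗ[K] K) (hφZ : ∀ v ∈ Z, φ v = 0)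
    (hφ : ∀ (x : L) v, φ ⁅x, v⁆ = 0) : φ = 0 := by
  have := functional_eq_zero_of_no_invariants h1 _ (V ⧸ Z) rfl (by
    intro q hq
    obtain ⟨v, rfl⟩ := LieSubmodule.Quotient.surjective_mk' Z q
    rw [LieSubmodule.Quotient.mk'_apply, LieSubmodule.Quotient.mk_eq_zero', ← hZ,
      LieSubmodule.mem_normalizer]
    intro x
    have := hq x
    rwa [← LieModuleHom.map_lie, LieSubmodule.Quotient.mk'_apply,
        LieSubmodule.Quotient.mk_eq_zero'] at this)
    ((Z : Submodule K V).liftQ φ hφZ) (by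
    intro x q
    obtain ⟨v, rfl⟩ := LieSubmodule.Quotient.surjective_mk' Z q
    rw [← LieModuleHom.map_lie]
    exact hφ x v)
  ext v
  exact LinearMap.congr_fun this (LieSubmodule.Quotient.mk v)

theorem trace_ad_eq_zero [FiniteDimensional K L]
    (h1 : ∀ (V : Type) [AddCommGroup V] [Module K V] [LieRingModule L V]
      [LieModule K L V] [FiniteDimensional K V],
      LieModule.IsIrreducible K L V → ¬ LieModule.IsTrivial L V →
      cohomologyVanishes K L V 1)
    (x : L) :
    LinearMap.trace K L (LieAlgebra.ad K L x) = 0 := by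
  obtain ⟨k, hk⟩ := WellFoundedGT.monotone_chain_condition
    (⟨fun k => (⊥ : LieSubmodule K L L).ucs k, monotone_nat_of_le_succ fun k => by
      rw [LieSubmodule.ucs_succ]; exact LieSubmodule.le_normalizer _⟩ :
      ℕ →o LieSubmodule K L L)
  set Z := (⊥ : LieSubmodule K L L).ucs k with hZ
  have hnorm : Z.normalizer = Z := by
    rw [hZ, ← LieSubmodule.ucs_succ]
    exact (hk (k + 1) (by omega)).symm
  have hnil : ∀ x ∈ Z, LinearMap.trace K L (LieAlgebra.ad K L x) = 0 := by
    intro x hx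
    have key : ∀ (j : ℕ) (y : L), ((LieAlgebra.ad K L x) ^ (j + 1)) y ∈
        (⊥ : LieSubmodule K L L).ucs (k - j) := by
      intro j
      induction j with
      | zero =>
        intro y
        simpa using lie_mem_left K L Z x y hx
      | succ j ih =>
        intro y
        rw [pow_succ', Module.End.mul_apply]
        by_cases hj : j < k
        · have := ih y
          rw [show k - j = (k - (j + 1)) + 1 by omega, LieSubmodule.ucs_succ] at this
          exact LieSubmodule.mem_normalizer _ _ |>.1 this x
        · have := ih y
          rw [show k - j = 0 by omega] at this
          rw [show k - (j + 1) = 0 by omega]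
          exact LieSubmodule.lie_mem _ this
    have : IsNilpotent (LieAlgebra.ad K L x) := ⟨k + 1, by
      ext y
      simpa using key k y⟩
    exact (LinearMap.isNilpotent_trace_of_isNilpotent this).eq_zero
  let τ : L →ₗ[K] K := LinearMap.trace K L ∘ₗ (LieAlgebra.ad K L : L →ₗ[K] Module.End K L)
  have := functional_eq_zero_of_normalizer_eq h1 L Z hnorm τ hnil (by
    intro x v
    change LinearMap.trace K L (LieAlgebra.ad K L ⁅x, v⁆) = 0
    have : LieAlgebra.ad K L ⁅x, v⁆ = LieAlgebra.ad K L x * LieAlgebra.ad K L v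
        - LieAlgebra.ad K L v * LieAlgebra.ad K L x := by
      ext y
      simp
    rw [this, map_sub, LinearMap.trace_mul_comm, sub_self])
  exact LinearMap.congr_fun this x

end H1

/-- The dual of an irreducible module is irreducible. -/
theorem isIrreducible_dual {K : Type} [Field K] {L : Type} [LieRing L] [LieAlgebra K L]
    {V : Type} [AddCommGroup V] [Module K V] [LieRingModule L V] [LieModule K L V]
    [FiniteDimensional K V] (hV : LieModule.IsIrreducible K L V) :
    LieModule.IsIrreducible K L (V →ₗ[K] K) := by
  have : Nontrivial V := (LieSubmodule.nontrivial_iff K L V).1 hV.toNontrivial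
  have : Nontrivial (V →ₗ[K] K) := inferInstanceAs (Nontrivial (Module.Dual K V))
  refine LieModule.IsIrreducible.mk fun W hW => ?_
  let N : LieSubmodule K L V :=
    { (W : Submodule K (Module.Dual K V)).dualCoannihilator with
      lie_mem := fun {x v} hv => by
        refine (Submodule.mem_dualCoannihilator _).2 fun φ hφ => ?_
        have := (Submodule.mem_dualCoannihilator _).1 hv ⁅x, φ⁆ (W.lie_mem hφ)
        simpa using this }
  have hN : (N : Submodule K V) = (W : Submodule K (Module.Dual K V)).dualCoannihilator := rfl
  have hann : (N : Submodule K V).dualAnnihilator = (W : Submodule K (Module.Dual K V)) := by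
    rw [hN, Subspace.dualCoannihilator_dualAnnihilator_eq]
  rcases hV.eq_bot_or_eq_top N with h | h
  · rw [h, LieSubmodule.bot_toSubmodule, Submodule.dualAnnihilator_bot] at hann
    exact LieSubmodule.toSubmodule_injective hann.symm
  · rw [h, LieSubmodule.top_toSubmodule, Submodule.dualAnnihilator_top] at hann
    exact absurd (LieSubmodule.toSubmodule_injective hann.symm) hW

theorem not_isTrivial_dual {K : Type} [Field K] {L : Type} [LieRing L] [LieAlgebra K L]
    {V : Type} [AddCommGroup V] [Module K V] [LieRingModule L V] [LieModule K L V]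
    (hT : ¬ LieModule.IsTrivial L V) : ¬ LieModule.IsTrivial L (V →ₗ[K] K) := by
  refine fun h => hT ⟨fun x v => ?_⟩
  refine (Module.forall_dual_apply_eq_zero_iff K _).1 fun φ => ?_
  have := LinearMap.congr_fun (h.trivial x φ) v
  simpa using this

section TopForms

variable {K : Type} [Field K] {L : Type} [LieRing L] [LieAlgebra K L]
  {V : Type} [AddCommGroup V] [Module K V]

theorem derivArgs_apply_basis {n : ℕ} (b : Module.Basis (Fin n) K L) (A : L →ₗ[K] L)
    (F : L [⋀^Fin n]→ₗ[K] V) : derivArgs A F b = LinearMap.trace K L A • F b := by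
  rw [derivArgs_apply, LinearMap.trace_eq_matrix_trace K b, Matrix.trace, Finset.sum_smul]
  refine Finset.sum_congr rfl fun j _ => ?_
  conv_lhs => rw [← b.sum_repr (A (b j))]
  rw [F.map_update_sum, Finset.sum_eq_single j]
  · rw [F.map_update_smul, Function.update_eq_self, Matrix.diag_apply, LinearMap.toMatrix_apply]
  · intro i _ hij
    rw [F.map_update_smul, F.map_eq_zero_of_eq _ (i := i) (j := j) _ hij, smul_zero]
    simp [hij]
  · simp

theorem derivArgs_eq_trace_smul {n : ℕ} (e : Module.Basis (Fin n) K L) (A : L →ₗ[K] L)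
    (F : L [⋀^Fin n]→ₗ[K] V) : derivArgs A F = LinearMap.trace K L A • F := by
  refine e.ext_alternating fun v hv => ?_
  let σ : Equiv.Perm (Fin n) := Equiv.ofBijective v (Finite.injective_iff_bijective.1 hv)
  have h := derivArgs_apply_basis (e.reindex σ.symm) A F
  have hb : (e.reindex σ.symm : Fin n → L) = fun i => e (v i) := by
    ext i
    simp [σ]
  rwa [hb] at h

/-- The top form `det_e ⊗ v`. -/
noncomputable def topForm {n : ℕ} (e : Module.Basis (Fin n) K L) :
    V →ₗ[K] L [⋀^Fin n]→ₗ[K] V where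
  toFun v := (LinearMap.toSpanSingleton K V v).compAlternatingMap e.det
  map_add' v w := by ext; simp
  map_smul' t v := by ext; simp [smul_comm t]

theorem topForm_apply {n : ℕ} (e : Module.Basis (Fin n) K L) (v : V) (w : Fin n → L) :
    topForm e v w = e.det w • v := rfl

theorem det_vecCons_succAbove {n : ℕ} (e : Module.Basis (Fin (n + 1)) K L) (i k : Fin (n + 1)) :
    e.det (Matrix.vecCons (e i) (e ∘ k.succAbove)) = if i = k then (-1) ^ (i : ℕ) else 0 := by
  split_ifs with h
  · subst h
    have h := e.det.neg_one_pow_smul_map_insertNth i (e i) (i.removeNth e)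
    rw [Fin.insertNth_self_removeNth, e.det_self] at h
    exact h.symm.trans (by simp)
  · obtain ⟨l, hl⟩ := Fin.exists_succAbove_eq h
    refine e.det.map_eq_zero_of_eq _ (i := 0) (j := l.succ) ?_ (Fin.succ_ne_zero _).symm
    simp [hl]

theorem alternatingMap_sum_apply {ι : Type} {n : ℕ} (s : Finset ι)
    (F : ι → L [⋀^Fin n]→ₗ[K] V) (w : Fin n → L) : (∑ i ∈ s, F i) w = ∑ i ∈ s, F i w := by
  classical
  induction s using Finset.induction_on with
  | empty => simp
  | insert a s ha ih => simp [Finset.sum_insert ha, ih]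

/-- Every cochain of codegree one is a sum of contractions of top forms. -/
theorem eq_sum_curryLeft_topForm {n : ℕ} (e : Module.Basis (Fin (n + 1)) K L)
    (f : L [⋀^Fin n]→ₗ[K] V) :
    f = ∑ i : Fin (n + 1),
      (topForm e ((-1 : K) ^ (i : ℕ) • f (e ∘ i.succAbove))).curryLeft (e i) := by
  refine e.ext_alternating fun v hv => ?_
  obtain ⟨k, hk⟩ : ∃ k, ∀ i, v i ≠ k := by
    by_contra! h
    have := Fintype.card_le_of_surjective v h
    simp at this
  choose σ hσ using fun i => Fin.exists_succAbove_eq (hk i)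
  have hσi : Function.Injective σ := fun i j hij => hv (by rw [← hσ i, ← hσ j, hij])
  let τ : Equiv.Perm (Fin n) := Equiv.ofBijective σ (Finite.injective_iff_bijective.1 hσi)
  have hw : (fun i => e (v i)) = (e ∘ k.succAbove) ∘ τ := by
    ext i
    simp [τ, hσ]
  rw [hw, AlternatingMap.map_perm, AlternatingMap.map_perm]
  congr 1
  rw [alternatingMap_sum_apply, Finset.sum_eq_single k]
  · rw [AlternatingMap.curryLeft_apply_apply, topForm_apply, det_vecCons_succAbove, if_pos rfl,
      smul_smul, ← mul_pow]
    simp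
  · intro i _ hik
    rw [AlternatingMap.curryLeft_apply_apply, topForm_apply, det_vecCons_succAbove, if_neg hik,
      zero_smul]
  · simp

variable [LieRingModule L V] [LieModule K L V]

theorem d_topForm {n : ℕ} (e : Module.Basis (Fin n) K L) (v : V) (w : Fin (n + 1) → L) :
    d (topForm e v) w = 0 := by
  obtain ⟨D, hD⟩ := exists_linearMap_eq_d (K := K) (L := L) (V := V) n
  rw [← hD]
  have : D (topForm e v) = 0 := by
    refine e.ext_alternating fun u hu => ?_
    have := Fintype.card_le_of_injective u hu
    simp at this
  rw [this, AlternatingMap.zero_apply]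

theorem lieDeriv_topForm {n : ℕ}
    (hL : ∀ x : L, LinearMap.trace K L (LieAlgebra.ad K L x) = 0)
    (e : Module.Basis (Fin n) K L) (x : L) (v : V) :
    lieDeriv (topForm e v) x = topForm e ⁅x, v⁆ := by
  change (LieModule.toEnd K L V x).compAlternatingMap _ - derivArgs (LieAlgebra.ad K L x) _ = _
  rw [derivArgs_eq_trace_smul e, hL, zero_smul, sub_zero]
  ext w
  simp [topForm_apply]

theorem d_curryLeft_topForm {n : ℕ}
    (hL : ∀ x : L, LinearMap.trace K L (LieAlgebra.ad K L x) = 0)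
    (e : Module.Basis (Fin (n + 1)) K L) (x : L) (v : V)
    (w : Fin (n + 1) → L) : d ((topForm e v).curryLeft x) w = topForm e ⁅x, v⁆ w := by
  have h := d_vecCons (topForm e v) x w
  rw [d_topForm, lieDeriv_topForm hL] at h
  exact (sub_eq_zero.1 h.symm).symm

theorem d_curryLeft_curryLeft_topForm {n : ℕ}
    (hL : ∀ x : L, LinearMap.trace K L (LieAlgebra.ad K L x) = 0)
    (e : Module.Basis (Fin (n + 2)) K L) (x y : L)
    (v : V) (w : Fin (n + 1) → L) :
    d (((topForm e v).curryLeft x).curryLeft y) w =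
      (topForm e ⁅y, v⁆).curryLeft x w + (topForm e v).curryLeft ⁅y, x⁆ w
        - (topForm e ⁅x, v⁆).curryLeft y w := by
  have h := d_vecCons ((topForm e v).curryLeft x) y w
  have h' := lieDeriv_vecCons (topForm e v) y x w
  rw [d_curryLeft_topForm hL] at h
  rw [lieDeriv_topForm hL] at h'
  simp only [AlternatingMap.curryLeft_apply_apply]
  rw [h, h']
  abel

/-- Poincaré duality in codegree one for unimodular Lie algebras. -/
theorem cohomologyVanishes_of_dual_cohomologyVanishes_one {n : ℕ}
    (hL : ∀ x : L, LinearMap.trace K L (LieAlgebra.ad K L x) = 0)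
    (e : Module.Basis (Fin (n + 2)) K L) (hV : cohomologyVanishes K L (V →ₗ[K] K) 1) :
    cohomologyVanishes K L V (n + 1) := by
  intro f hf
  obtain ⟨D, hD⟩ := exists_linearMap_eq_d (K := K) (L := L) (V := V) n
  suffices h : f ∈ LinearMap.range D by
    obtain ⟨g, rfl⟩ := h
    exact ⟨g, fun x => hD g x⟩
  by_contra hfD
  obtain ⟨φ, hφf, hφ⟩ := Submodule.exists_dual_map_eq_bot_of_notMem hfD inferInstance
  have hφD : ∀ g, φ (D g) = 0 := fun g => by
    have : φ (D g) ∈ (LinearMap.range D).map φ := Submodule.mem_map_of_mem ⟨g, rfl⟩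
    simpa [hφ] using this
  let c : L →ₗ[K] V →ₗ[K] K := LinearMap.mk₂ K (fun x v => φ ((topForm e v).curryLeft x))
    (fun x y v => by simp) (fun t x v => by simp) (fun x v w => by simp) (fun t x v => by simp)
  have hc : ∀ x v, c x v = φ ((topForm e v).curryLeft x) := fun _ _ => rfl
  obtain ⟨l, hl⟩ := exists_eq_lie_of_cohomologyVanishes_one hV c (fun y x => by
    ext v
    have h : D (((topForm e v).curryLeft x).curryLeft y) =
        (topForm e ⁅y, v⁆).curryLeft x + (topForm e v).curryLeft ⁅y, x⁆
          - (topForm e ⁅x, v⁆).curryLeft y := by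
      ext w
      rw [hD, d_curryLeft_curryLeft_topForm hL]
      rfl
    have h0 := hφD (((topForm e v).curryLeft x).curryLeft y)
    rw [h, map_sub, map_add, ← hc, ← hc, ← hc] at h0
    rw [LinearMap.sub_apply, Module.Dual.lie_apply, Module.Dual.lie_apply]
    linear_combination h0)
  have hφl : ∀ x v, φ ((topForm e v).curryLeft x) = - l ⁅x, v⁆ := fun x v => by
    rw [← hc, hl, Module.Dual.lie_apply]
  have hf' := eq_sum_curryLeft_topForm e f
  set u : Fin (n + 2) → V := fun i => (-1 : K) ^ (i : ℕ) • f (e ∘ i.succAbove) with hu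
  have hsum : ∑ i, ⁅e i, u i⁆ = 0 := by
    obtain ⟨D', hD'⟩ := exists_linearMap_eq_d (K := K) (L := L) (V := V) (n + 1)
    have h := hf e
    rw [← hD', hf', map_sum, alternatingMap_sum_apply] at h
    simpa [hu, hD', d_curryLeft_topForm hL, topForm_apply, e.det_self] using h
  refine hφf ?_
  rw [hf', map_sum]
  simp only [hφl]
  rw [Finset.sum_neg_distrib, ← map_sum, hsum, map_zero, neg_zero]

end TopForms

end CE

/-- If `H¹(L, V) = 0` for every finite-dimensional non-trivial
irreducible `L`-module `V`, then `H^{dim L − 1}(L, V) = 0` for every such module. -/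
theorem top_vanishes_of_h1_vanishes
    (K : Type) [Field K] [CharZero K]
    (L : Type) [LieRing L] [LieAlgebra K L] [FiniteDimensional K L]
    (h1 : ∀ (V : Type) [AddCommGroup V] [Module K V] [LieRingModule L V]
      [LieModule K L V] [FiniteDimensional K V],
      LieModule.IsIrreducible K L V → ¬ LieModule.IsTrivial L V →
      CE.cohomologyVanishes K L V 1) :
    ∀ (V : Type) [AddCommGroup V] [Module K V] [LieRingModule L V]
      [LieModule K L V] [FiniteDimensional K V],
      LieModule.IsIrreducible K L V → ¬ LieModule.IsTrivial L V →
      CE.cohomologyVanishes K L V (Module.finrank K L - 1) := by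
  intro V _ _ _ _ _ hV hT
  rcases hn : Module.finrank K L - 1 with _ | n
  · intro f hf
    ext v
    have : f ![] = 0 := CE.eq_zero_of_forall_lie_eq_zero hV hT fun x => by
      simpa [CE.d_zero] using hf ![x]
    rw [Subsingleton.elim v ![], this, AlternatingMap.zero_apply]
  · exact CE.cohomologyVanishes_of_dual_cohomologyVanishes_one (CE.trace_ad_eq_zero h1)
      (Module.finBasisOfFinrankEq K L (n := n + 2) (by omega))
      (h1 _ (CE.isIrreducible_dual hV) (CE.not_isTrivial_dual hT))
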